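/- arXiv:2507.11251 — 5 statements merged into one kernel-verified Lean document; each statement's English description precedes it below -/
import Mathlib

section
/- Let H be a complex inner product space and let u₀, u₁, w be unit vectors in H. Let V₀, V₁ ∈ [0,1] and suppose |⟪w, u₀⟫|² ≥ V₀ and |⟪w, u₁⟫|² ≥ V₁. Then |⟪u₀, u₁⟫| ≥ √(V₀·V₁) − √((1−V₀)·(1−V₁)). -/
open scoped InnerProductSpace

/-- The inner product of the components of `x` and `y` orthogonal to a unit vector `w`. -/
theorem inner_sub_inner_smul_sub_inner_smul {H : Type*} [NormedAddCommGroup H]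
    [InnerProductSpace ℂ H] {w : H} (hw : ‖w‖ = 1) (x y : H) :
    ⟪x - ⟪w, x⟫_ℂ • w, y - ⟪w, y⟫_ℂ • w⟫_ℂ = ⟪x, y⟫_ℂ - ⟪x, w⟫_ℂ * ⟪w, y⟫_ℂ := by
  have hww : ⟪w, w⟫_ℂ = 1 := by simp [inner_self_eq_norm_sq_to_K, hw]
  simp only [inner_sub_left, inner_sub_right, inner_smul_left, inner_smul_right,
    inner_conj_symm, hww]
  ring

/-- Pythagoras for the component of `x` orthogonal to a unit vector `w`. -/
theorem norm_sub_inner_smul_sq {H : Type*} [NormedAddCommGroup H]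
    [InnerProductSpace ℂ H] {w : H} (hw : ‖w‖ = 1) (x : H) :
    ‖x - ⟪w, x⟫_ℂ • w‖ ^ 2 = ‖x‖ ^ 2 - ‖⟪w, x⟫_ℂ‖ ^ 2 := by
  have h := inner_sub_inner_smul_sub_inner_smul hw x x
  rw [← inner_conj_symm x w, inner_self_eq_norm_sq_to_K, inner_self_eq_norm_sq_to_K,
    RCLike.conj_mul] at h
  exact_mod_cast h

/-- Cauchy–Schwarz for the components of `x` and `y` orthogonal to a unit vector `w`. -/
theorem norm_inner_mul_norm_inner_sub_le {H : Type*} [NormedAddCommGroup H]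
    [InnerProductSpace ℂ H] {w : H} (hw : ‖w‖ = 1) (x y : H) :
    ‖⟪w, x⟫_ℂ‖ * ‖⟪w, y⟫_ℂ‖ - ‖x - ⟪w, x⟫_ℂ • w‖ * ‖y - ⟪w, y⟫_ℂ • w‖ ≤ ‖⟪x, y⟫_ℂ‖ := by
  have hcs := norm_inner_le_norm (𝕜 := ℂ) (x - ⟪w, x⟫_ℂ • w) (y - ⟪w, y⟫_ℂ • w)
  rw [inner_sub_inner_smul_sub_inner_smul hw, norm_sub_rev] at hcs
  have htri := norm_sub_norm_le (⟪x, w⟫_ℂ * ⟪w, y⟫_ℂ) ⟪x, y⟫_ℂ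
  rw [norm_mul, norm_inner_symm x w] at htri
  linarith

/-- Overlap bound: if two unit vectors each have squared overlap with a reference unit
vector `w` bounded below by `V₀` and `V₁`, then their mutual overlap is bounded below
by `√(V₀·V₁) − √((1−V₀)·(1−V₁))`. -/
theorem overlap_lower_bound {H : Type*} [NormedAddCommGroup H] [InnerProductSpace ℂ H]
    (u₀ u₁ w : H) (hu₀ : ‖u₀‖ = 1) (hu₁ : ‖u₁‖ = 1) (hw : ‖w‖ = 1)
    (V₀ V₁ : ℝ) (hV₀ : V₀ ∈ Set.Icc (0 : ℝ) 1) (hV₁ : V₁ ∈ Set.Icc (0 : ℝ) 1)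
    (h₀ : V₀ ≤ ‖⟪w, u₀⟫_ℂ‖ ^ 2) (h₁ : V₁ ≤ ‖⟪w, u₁⟫_ℂ‖ ^ 2) :
    Real.sqrt (V₀ * V₁) - Real.sqrt ((1 - V₀) * (1 - V₁)) ≤ ‖⟪u₀, u₁⟫_ℂ‖ := by
  have hV₀' : Real.sqrt V₀ ≤ ‖⟪w, u₀⟫_ℂ‖ := Real.sqrt_le_iff.2 ⟨norm_nonneg _, h₀⟩
  have hV₁' : Real.sqrt V₁ ≤ ‖⟪w, u₁⟫_ℂ‖ := Real.sqrt_le_iff.2 ⟨norm_nonneg _, h₁⟩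
  have hp₀ : ‖u₀ - ⟪w, u₀⟫_ℂ • w‖ ≤ Real.sqrt (1 - V₀) :=
    Real.le_sqrt_of_sq_le (by rw [norm_sub_inner_smul_sq hw, hu₀]; linarith)
  have hp₁ : ‖u₁ - ⟪w, u₁⟫_ℂ • w‖ ≤ Real.sqrt (1 - V₁) :=
    Real.le_sqrt_of_sq_le (by rw [norm_sub_inner_smul_sq hw, hu₁]; linarith)
  rw [Real.sqrt_mul hV₀.1, Real.sqrt_mul (sub_nonneg.2 hV₀.2)]
  refine le_trans ?_ (norm_inner_mul_norm_inner_sub_le hw u₀ u₁)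
  gcongr
end

section
/- Let H be a complex inner product space, let s, t ∈ ℝ, and let a₀₀, a₀₁, a₁₀, a₁₁ be unit vectors in H whose pairwise inner products have the product form ⟪a_{ij}, a_{kl}⟫ = σ_{ik}·τ_{jl}, where σ_{ik} = 1 if i = k and σ_{ik} = s otherwise, and τ_{jl} = 1 if j = l and τ_{jl} = t otherwise. Then for all real c₀, c₁ > 0 with c₀·c₁ = 1, ‖a₀₁ + a₁₀ − c₀·a₀₀ − c₁·a₁₁‖² = (c₀ + c₁ − 2s)·(c₀ + c₁ − 2t). -/
open scoped InnerProductSpace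

/-- For four unit vectors `a i j` with product-form pairwise inner products
`⟪a i j, a k l⟫ = σ_{ik}·τ_{jl}` (where `σ_{ik} = 1` if `i = k` and `s` otherwise,
`τ_{jl} = 1` if `j = l` and `t` otherwise), and positive reals `c₀ c₁` with
`c₀·c₁ = 1`, one has `‖a₀₁ + a₁₀ − c₀·a₀₀ − c₁·a₁₁‖² = (c₀+c₁−2s)(c₀+c₁−2t)`. -/
theorem norm_sq_remainder_eq {H : Type*} [NormedAddCommGroup H] [InnerProductSpace ℂ H]
    (s t : ℝ) (a : Fin 2 → Fin 2 → H)
    (hunit : ∀ i j, ‖a i j‖ = 1)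
    (hinner : ∀ i j k l, ⟪a i j, a k l⟫_ℂ =
      (if i = k then 1 else (s : ℂ)) * (if j = l then 1 else (t : ℂ)))
    (c₀ c₁ : ℝ) (hc₀ : 0 < c₀) (hc₁ : 0 < c₁) (hc : c₀ * c₁ = 1) :
    ‖a 0 1 + a 1 0 - (c₀ : ℂ) • a 0 0 - (c₁ : ℂ) • a 1 1‖ ^ 2 =
      (c₀ + c₁ - 2 * s) * (c₀ + c₁ - 2 * t) := by
  apply Complex.ofReal_injective
  have hc' : (c₀ : ℂ) * c₁ = 1 := by exact_mod_cast hc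
  push_cast
  refine (inner_self_eq_norm_sq_to_K (𝕜 := ℂ) (E := H) _).symm.trans ?_
  simp only [inner_sub_left, inner_sub_right, inner_add_left, inner_add_right,
    inner_smul_left, inner_smul_right, hinner, Complex.conj_ofReal]
  simp only [Fin.isValue, zero_ne_one, one_ne_zero, if_true, if_false]
  linear_combination (2 * (s : ℂ) * t - 2) * hc'
end

section
/- Let X ≥ 0 be a real number, let ε ∈ (0,1), and set L = ln(1/ε). Define Cher⁺(X, ε) = X + L + √(L² + 2·X·L) and cher⁻(E, ε) = E − √(2·E·L). Then cher⁻(Cher⁺(X, ε), ε) = X. -/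
/-- The paper's upper Chernoff estimate of an expectation from an observation `X`:
`Cher⁺(X, ε) = X + ln(1/ε) + √(ln²(1/ε) + 2X·ln(1/ε))`. -/
noncomputable def CherPlus (X ε : ℝ) : ℝ :=
  X + Real.log (1 / ε) + Real.sqrt ((Real.log (1 / ε)) ^ 2 + 2 * X * Real.log (1 / ε))

/-- The paper's lower Chernoff estimate of an observation from an expectation `E`:
`cher⁻(E, ε) = E − √(2E·ln(1/ε))`. -/
noncomputable def cherMinus (E ε : ℝ) : ℝ :=
  E - Real.sqrt (2 * E * Real.log (1 / ε))

/-- `cher⁻` is an exact inverse of `Cher⁺`: `cher⁻(Cher⁺(X, ε), ε) = X`. -/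
theorem cherMinus_CherPlus (X ε : ℝ) (hX : 0 ≤ X) (hε : ε ∈ Set.Ioo (0 : ℝ) 1) :
    cherMinus (CherPlus X ε) ε = X := by
  have hL : 0 ≤ Real.log (1 / ε) :=
    Real.log_nonneg (by rw [le_div_iff₀ hε.1, one_mul]; exact hε.2.le)
  unfold cherMinus CherPlus
  set L := Real.log (1 / ε)
  have hS : Real.sqrt (L ^ 2 + 2 * X * L) ^ 2 = L ^ 2 + 2 * X * L :=
    Real.sq_sqrt (by positivity)
  set S := Real.sqrt (L ^ 2 + 2 * X * L)
  have hsq : 2 * (X + L + S) * L = (L + S) ^ 2 := by linear_combination -hS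
  rw [hsq, Real.sqrt_sq (by positivity)]
  ring
end

section
/- Let ε ∈ (0,1), set L = ln(1/ε), and let X be a real number with X ≥ 3L/8. Define Cher⁻(X, ε) = X + L/2 − (1/2)·√(L² + 8·X·L) and cher⁺(E, ε) = E + L/2 + (1/2)·√(L² + 8·E·L). Then cher⁺(Cher⁻(X, ε), ε) = X. -/
/-- The paper's lower Chernoff estimate of an expectation from an observation `X`:
`Cher⁻(X, ε) = X + (1/2)ln(1/ε) − (1/2)√(ln²(1/ε) + 8X·ln(1/ε))`. -/
noncomputable def CherMinus (X ε : ℝ) : ℝ :=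
  X + Real.log (1 / ε) / 2 -
    (1 / 2) * Real.sqrt ((Real.log (1 / ε)) ^ 2 + 8 * X * Real.log (1 / ε))

/-- The paper's upper Chernoff estimate of an observation from an expectation `E`:
`cher⁺(E, ε) = E + (1/2)ln(1/ε) + (1/2)√(ln²(1/ε) + 8E·ln(1/ε))`. -/
noncomputable def cherPlus (E ε : ℝ) : ℝ :=
  E + Real.log (1 / ε) / 2 +
    (1 / 2) * Real.sqrt ((Real.log (1 / ε)) ^ 2 + 8 * E * Real.log (1 / ε))

/-- For `X ≥ 3L/8` (with `L = ln(1/ε)`), `cher⁺` inverts `Cher⁻`: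
`cher⁺(Cher⁻(X, ε), ε) = X`. -/
theorem cherPlus_CherMinus (X ε : ℝ) (hε : ε ∈ Set.Ioo (0 : ℝ) 1)
    (hX : 3 * Real.log (1 / ε) / 8 ≤ X) :
    cherPlus (CherMinus X ε) ε = X := by
  have hL : 0 < Real.log (1 / ε) :=
    Real.log_pos (by rw [lt_div_iff₀ hε.1]; linarith [hε.2])
  unfold cherPlus CherMinus
  set L := Real.log (1 / ε)
  set S := Real.sqrt (L ^ 2 + 8 * X * L)
  have hS_sq : S ^ 2 = L ^ 2 + 8 * X * L := Real.sq_sqrt (by nlinarith)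
  have hS_ge : 2 * L ≤ S := Real.le_sqrt_of_sq_le (by nlinarith)
  have h_sq : L ^ 2 + 8 * (X + L / 2 - 1 / 2 * S) * L = (S - 2 * L) ^ 2 := by
    linear_combination -hS_sq
  rw [h_sq, Real.sqrt_sq (by linarith)]
  ring
end

section
/- Let H be a complex inner product space, let s, t ∈ ℝ, and let a₀₀, a₀₁, a₁₀, a₁₁ be unit vectors in H with ⟪a_{ij}, a_{kl}⟫ = σ_{ik}·τ_{jl}, where σ_{ik} = 1 if i = k and s otherwise, and τ_{jl} = 1 if j = l and t otherwise. Let c₀, c₁ > 0 with c₀·c₁ = 1, suppose c₀ + c₁ ≥ 2s and c₀ + c₁ ≥ 2t, and set c̄₂ = √((c₀ + c₁ − 2s)·(c₀ + c₁ − 2t)). Let J be a finite index set and (f_j)_{j∈J} a family of vectors in H with ∑_{j∈J} ‖f_j‖² ≤ 1, and set S₀ = ∑_j |⟪f_j, a₀₀⟫|² and S₁ = ∑_j |⟪f_j, a₁₁⟫|². Then ∑_{j∈J} |⟪f_j, a₀₁ + a₁₀⟫|² ≤ c₀²·S₀ + c₁²·S₁ + c̄₂² + 2c₀c₁·√(S₀·S₁)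 + 2c₀c̄₂·√S₀ + 2c₁c̄₂·√S₁. -/
open scoped InnerProductSpace
open Finset

/-- The residual of `a₀₁ + a₁₀` against `c₀a₀₀ + c₁a₁₁` has squared norm
`(c₀ + c₁ - 2s)(c₀ + c₁ - 2t)`. -/
lemma norm_sq_residual {H : Type*} [NormedAddCommGroup H] [InnerProductSpace ℂ H]
    (s t : ℝ) (a : Fin 2 → Fin 2 → H)
    (hinner : ∀ i j k l, ⟪a i j, a k l⟫_ℂ =
      (if i = k then 1 else (s : ℂ)) * (if j = l then 1 else (t : ℂ)))
    (c₀ c₁ : ℝ) (hc : c₀ * c₁ = 1) :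
    ‖a 0 1 + a 1 0 - ((c₀ : ℂ) • a 0 0 + (c₁ : ℂ) • a 1 1)‖ ^ 2 =
      (c₀ + c₁ - 2 * s) * (c₀ + c₁ - 2 * t) := by
  have hc' : (c₀ : ℂ) * c₁ = 1 := by exact_mod_cast hc
  have h : ((‖a 0 1 + a 1 0 - ((c₀ : ℂ) • a 0 0 + (c₁ : ℂ) • a 1 1)‖ ^ 2 : ℝ) : ℂ) =
      (((c₀ + c₁ - 2 * s) * (c₀ + c₁ - 2 * t) : ℝ) : ℂ) := by
    push_cast
    refine (inner_self_eq_norm_sq_to_K (𝕜 := ℂ)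
      (a 0 1 + a 1 0 - ((c₀ : ℂ) • a 0 0 + (c₁ : ℂ) • a 1 1))).symm.trans ?_
    simp only [inner_add_left, inner_add_right, inner_sub_left, inner_sub_right,
      inner_smul_left, inner_smul_right, hinner, Complex.conj_ofReal]
    norm_num
    linear_combination (2 * (s : ℂ) * t - 2) * hc'
  exact_mod_cast h

/-- Expanding `∑ (x + y + z)²` and applying the Cauchy–Schwarz inequality to the cross terms. -/
lemma sum_sq_add_add_le {J : Type*} [Fintype J] (x y z : J → ℝ) (p q c : ℝ)
    (hp : 0 ≤ p) (hq : 0 ≤ q) (hc : 0 ≤ c) (hz : ∑ j, z j ^ 2 ≤ c ^ 2) :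
    ∑ j, (p * x j + q * y j + z j) ^ 2 ≤
      p ^ 2 * ∑ j, x j ^ 2 + q ^ 2 * ∑ j, y j ^ 2 + c ^ 2 +
        2 * p * q * √((∑ j, x j ^ 2) * ∑ j, y j ^ 2) +
        2 * p * c * √(∑ j, x j ^ 2) + 2 * q * c * √(∑ j, y j ^ 2) := by
  have hzc : √(∑ j, z j ^ 2) ≤ c := Real.sqrt_le_iff.mpr ⟨hc, hz⟩
  have hxy : ∑ j, x j * y j ≤ √((∑ j, x j ^ 2) * ∑ j, y j ^ 2) := by
    rw [Real.sqrt_mul (by positivity)]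
    exact Real.sum_mul_le_sqrt_mul_sqrt _ _ _
  have hcross (u : J → ℝ) : ∑ j, u j * z j ≤ c * √(∑ j, u j ^ 2) := by
    rw [mul_comm c]
    exact (Real.sum_mul_le_sqrt_mul_sqrt _ _ _).trans (by gcongr)
  have hexp : ∑ j, (p * x j + q * y j + z j) ^ 2 =
      p ^ 2 * ∑ j, x j ^ 2 + q ^ 2 * ∑ j, y j ^ 2 + ∑ j, z j ^ 2 +
        2 * p * q * ∑ j, x j * y j + 2 * p * ∑ j, x j * z j + 2 * q * ∑ j, y j * z j := by
    simp only [mul_sum, ← sum_add_distrib]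
    exact sum_congr rfl fun j _ => by ring
  rw [hexp, mul_assoc (2 * p) c, mul_assoc (2 * q) c]
  gcongr
  · exact hcross x
  · exact hcross y

/-- Abstract phase error bound: combining the decomposition
`a₀₁ + a₁₀ = c₀a₀₀ + c₁a₁₁ + c̄₂φ₂` with the Cauchy–Schwarz expansion, for a family
`(f j)` with `∑ j ‖f j‖² ≤ 1`:
`∑ j |⟪f j, a₀₁ + a₁₀⟫|² ≤ c₀²S₀ + c₁²S₁ + c̄₂² + 2c₀c₁√(S₀S₁) + 2c₀c̄₂√S₀ + 2c₁c̄₂√S₁`. -/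
theorem phase_error_bound {H : Type*} [NormedAddCommGroup H] [InnerProductSpace ℂ H]
    (s t : ℝ) (a : Fin 2 → Fin 2 → H)
    (hunit : ∀ i j, ‖a i j‖ = 1)
    (hinner : ∀ i j k l, ⟪a i j, a k l⟫_ℂ =
      (if i = k then 1 else (s : ℂ)) * (if j = l then 1 else (t : ℂ)))
    (c₀ c₁ : ℝ) (hc₀ : 0 < c₀) (hc₁ : 0 < c₁) (hc : c₀ * c₁ = 1)
    (hs : 2 * s ≤ c₀ + c₁) (ht : 2 * t ≤ c₀ + c₁)
    (c₂ : ℝ) (hc₂ : c₂ = Real.sqrt ((c₀ + c₁ - 2 * s) * (c₀ + c₁ - 2 * t)))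
    {J : Type*} [Fintype J] (f : J → H) (hf : ∑ j : J, ‖f j‖ ^ 2 ≤ 1)
    (S₀ S₁ : ℝ) (hS₀ : S₀ = ∑ j : J, ‖⟪f j, a 0 0⟫_ℂ‖ ^ 2)
    (hS₁ : S₁ = ∑ j : J, ‖⟪f j, a 1 1⟫_ℂ‖ ^ 2) :
    ∑ j : J, ‖⟪f j, a 0 1 + a 1 0⟫_ℂ‖ ^ 2 ≤
      c₀ ^ 2 * S₀ + c₁ ^ 2 * S₁ + c₂ ^ 2 +
        2 * c₀ * c₁ * Real.sqrt (S₀ * S₁) +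
        2 * c₀ * c₂ * Real.sqrt S₀ + 2 * c₁ * c₂ * Real.sqrt S₁ := by
  subst hS₀ hS₁
  set w := a 0 1 + a 1 0 - ((c₀ : ℂ) • a 0 0 + (c₁ : ℂ) • a 1 1) with hw
  have hc₂_nonneg : 0 ≤ c₂ := hc₂ ▸ Real.sqrt_nonneg _
  have hw_norm : ‖w‖ ^ 2 = c₂ ^ 2 := by
    rw [hc₂, Real.sq_sqrt (mul_nonneg (by linarith) (by linarith))]
    exact norm_sq_residual s t a hinner c₀ c₁ hc
  have hw_sum : ∑ j, ‖⟪f j, w⟫_ℂ‖ ^ 2 ≤ c₂ ^ 2 := by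
    calc ∑ j, ‖⟪f j, w⟫_ℂ‖ ^ 2 ≤ ∑ j, ‖f j‖ ^ 2 * ‖w‖ ^ 2 := by
          gcongr with j
          rw [← mul_pow]
          gcongr
          exact norm_inner_le_norm _ _
      _ = (∑ j, ‖f j‖ ^ 2) * c₂ ^ 2 := by rw [← sum_mul, hw_norm]
      _ ≤ c₂ ^ 2 := mul_le_of_le_one_left (sq_nonneg _) hf
  refine le_trans (sum_le_sum fun j _ => ?_)
    (sum_sq_add_add_le _ _ _ c₀ c₁ c₂ hc₀.le hc₁.le hc₂_nonneg hw_sum)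
  gcongr
  have hdecomp : a 0 1 + a 1 0 = (c₀ : ℂ) • a 0 0 + (c₁ : ℂ) • a 1 1 + w := by
    rw [hw]; abel
  rw [hdecomp, inner_add_right, inner_add_right, inner_smul_right, inner_smul_right]
  refine norm_add₃_le.trans_eq ?_
  simp [abs_of_pos hc₀, abs_of_pos hc₁]
end
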